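/- Let (V, g, J, ω) be a Hermitian vector space of real dimension 6 and let ψ be a nonzero real 3-form of type (3,0)+(0,3). Then the linear map from the space [[λ^{2,0}]] of real 2-forms of type (2,0)+(0,2) to Λ⁵V* given by η ↦ η ∧ ψ is bijective. -/

import Mathlib

open scoped RealInnerProductSpace

/-- The wedge product of a 2-form with a 3-form (shuffle/determinant convention),
written pointwise. -/
def wedge23 {V : Type*} [AddCommGroup V] [Module ℝ V]
    (β : V → V → ℝ) (ψ : V [⋀^Fin 3]→ₗ[ℝ] ℝ) : V → V → V → V → V → ℝ :=
  fun a0 a1 a2 a3 a4 =>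
    β a0 a1 * ψ ![a2, a3, a4] - β a0 a2 * ψ ![a1, a3, a4]
      + β a0 a3 * ψ ![a1, a2, a4] - β a0 a4 * ψ ![a1, a2, a3]
      + β a1 a2 * ψ ![a0, a3, a4] - β a1 a3 * ψ ![a0, a2, a4]
      + β a1 a4 * ψ ![a0, a2, a3] + β a2 a3 * ψ ![a0, a1, a4]
      - β a2 a4 * ψ ![a0, a1, a3] + β a3 a4 * ψ ![a0, a1, a2]

set_option linter.unusedSimpArgs false
theorem sw2 {V : Type*} [AddCommGroup V] [Module ℝ V] (β : V [⋀^Fin 2]→ₗ[ℝ] ℝ) (x y : V) :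
    β ![y, x] = - β ![x, y] := by
  have := β.map_swap ![x, y] (i := 0) (j := 1) (by decide)
  rw [← this]; congr 1; ext k; fin_cases k <;> rfl

theorem sw3 {V : Type*} [AddCommGroup V] [Module ℝ V] (ψ : V [⋀^Fin 3]→ₗ[ℝ] ℝ) (x y z : V) :
    ψ ![y, x, z] = - ψ ![x, y, z] := by
  have := ψ.map_swap ![x, y, z] (i := 0) (j := 1) (by decide)
  rw [← this]; congr 1; ext k; fin_cases k <;> rfl

theorem sw3' {V : Type*} [AddCommGroup V] [Module ℝ V] (ψ : V [⋀^Fin 3]→ₗ[ℝ] ℝ) (x y z : V) :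
    ψ ![x, z, y] = - ψ ![x, y, z] := by
  have := ψ.map_swap ![x, y, z] (i := 1) (j := 2) (by decide)
  rw [← this]; congr 1; ext k; fin_cases k <;> rfl

def wedge23A {V : Type*} [AddCommGroup V] [Module ℝ V]
    (β : V [⋀^Fin 2]→ₗ[ℝ] ℝ) (ψ : V [⋀^Fin 3]→ₗ[ℝ] ℝ) : V [⋀^Fin 5]→ₗ[ℝ] ℝ where
  toFun v := wedge23 (fun u v => β ![u, v]) ψ (v 0) (v 1) (v 2) (v 3) (v 4)
  map_update_add' := by
    intro inst v i x y
    have hinst : inst = instDecidableEqFin 5 := Subsingleton.elim _ _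
    subst hinst
    have b1 : ∀ x y z, β ![x + y, z] = β ![x, z] + β ![y, z] := fun x y z => β.map_vecCons_add _ _ _
    have b2 : ∀ x y z, β ![z, x + y] = β ![z, x] + β ![z, y] := fun x y z => by
      rw [sw2 β (x + y) z, b1, sw2 β x z, sw2 β y z]; ring
    have p1 : ∀ x y z w, ψ ![x + y, z, w] = ψ ![x, z, w] + ψ ![y, z, w] :=
      fun x y z w => ψ.map_vecCons_add _ _ _
    have p2 : ∀ x y z w, ψ ![z, x + y, w] = ψ ![z, x, w] + ψ ![z, y, w] := fun x y z w => by
      rw [sw3 ψ (x + y) z, p1, sw3 ψ x z, sw3 ψ y z]; ring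
    have p3 : ∀ x y z w, ψ ![z, w, x + y] = ψ ![z, w, x] + ψ ![z, w, y] := fun x y z w => by
      rw [sw3' ψ z (x + y) w, p2, sw3' ψ z x w, sw3' ψ z y w]; ring
    fin_cases i <;> simp [wedge23, Function.update, b1, b2, p1, p2, p3] <;> ring
  map_update_smul' := by
    intro inst v i c x
    have hinst : inst = instDecidableEqFin 5 := Subsingleton.elim _ _
    subst hinst
    have b1 : ∀ x z, β ![c • x, z] = c * β ![x, z] := fun x z => β.map_vecCons_smul _ _ _
    have b2 : ∀ x z, β ![z, c • x] = c * β ![z, x] := fun x z => by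
      rw [sw2 β (c • x) z, b1, sw2 β x z]; ring
    have p1 : ∀ x z w, ψ ![c • x, z, w] = c * ψ ![x, z, w] :=
      fun x z w => ψ.map_vecCons_smul _ _ _
    have p2 : ∀ x z w, ψ ![z, c • x, w] = c * ψ ![z, x, w] := fun x z w => by
      rw [sw3 ψ (c • x) z, p1, sw3 ψ x z]; ring
    have p3 : ∀ x z w, ψ ![z, w, c • x] = c * ψ ![z, w, x] := fun x z w => by
      rw [sw3' ψ z (c • x) w, p2, sw3' ψ z x w]; ring
    fin_cases i <;> simp [wedge23, Function.update, b1, b2, p1, p2, p3] <;> ring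
  map_eq_zero_of_eq' := by
    have b0 : ∀ x, β ![x, x] = 0 := fun x => β.map_eq_zero_of_eq _ (i := 0) (j := 1) rfl (by decide)
    have p0 : ∀ x y, ψ ![x, x, y] = 0 := fun x y =>
      ψ.map_eq_zero_of_eq _ (i := 0) (j := 1) rfl (by decide)
    have p0' : ∀ x y, ψ ![y, x, x] = 0 := fun x y =>
      ψ.map_eq_zero_of_eq _ (i := 1) (j := 2) rfl (by decide)
    have p0'' : ∀ x y, ψ ![x, y, x] = 0 := fun x y =>
      ψ.map_eq_zero_of_eq _ (i := 0) (j := 2) rfl (by decide)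
    have bs : ∀ x y, β ![y, x] = - β ![x, y] := fun x y => by
      have := β.map_swap ![x, y] (i := 0) (j := 1) (by decide)
      rw [← this]; congr 1; ext k; fin_cases k <;> rfl
    have ps : ∀ x y z, ψ ![y, x, z] = - ψ ![x, y, z] := fun x y z => by
      have := ψ.map_swap ![x, y, z] (i := 0) (j := 1) (by decide)
      rw [← this]; congr 1; ext k; fin_cases k <;> rfl
    have ps' : ∀ x y z, ψ ![x, z, y] = - ψ ![x, y, z] := fun x y z => by
      have := ψ.map_swap ![x, y, z] (i := 1) (j := 2) (by decide)
      rw [← this]; congr 1; ext k; fin_cases k <;> rfl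
    have key : ∀ (v : Fin 5 → V) (i j : Fin 5), v i = v j → i < j →
        wedge23 (fun u v => β ![u, v]) ψ (v 0) (v 1) (v 2) (v 3) (v 4) = 0 := by
      intro v i j h hij
      have cb : ∀ i j : Fin 5, i < j → β ![v j, v i] = - β ![v i, v j] := fun i j _ => bs _ _
      have cp : ∀ i j k : Fin 5, i < j → ψ ![v j, v i, v k] = - ψ ![v i, v j, v k] :=
        fun i j k _ => ps _ _ _
      have cp' : ∀ i j k : Fin 5, i < j → ψ ![v k, v j, v i] = - ψ ![v k, v i, v j] :=
        fun i j k _ => ps' _ _ _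
      fin_cases i <;> fin_cases j <;> first | (exfalso; revert hij; decide) | skip
      all_goals
        simp only [wedge23]
        simp only [Fin.mk_one, Fin.zero_eta, Fin.reduceFinMk] at h
        rw [← h]
        simp (disch := decide) only [b0, p0, p0', p0'', cb, cp, cp']
        ring
    intro v i j h hij
    rcases lt_or_gt_of_ne hij with h' | h'
    · exact key v i j h h'
    · exact key v j i h.symm h'

theorem ext5 {V : Type*} [AddCommGroup V] [Module ℝ V] (b : Module.Basis (Fin 6) ℝ V)
    (f g : V [⋀^Fin 5]→ₗ[ℝ] ℝ)
    (h : ∀ k : Fin 6, f (fun i => b (k.succAbove i)) = g (fun i => b (k.succAbove i))) : f = g := by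
  apply b.ext_alternating
  intro v hv
  obtain ⟨k, hk⟩ : ∃ k, k ∉ Set.range v := by
    by_contra hcon
    push Not at hcon
    have := Fintype.card_le_of_surjective v (fun k => hcon k)
    simp at this
  have h1 : ∀ i, ∃ j, k.succAbove j = v i := fun i => by
    apply Fin.exists_succAbove_eq
    intro hh; exact hk ⟨i, hh⟩
  choose s hs using h1
  have sinj : Function.Injective s := fun i j hij => hv (by rw [← hs, ← hs, hij])
  let σ : Equiv.Perm (Fin 5) := Equiv.ofBijective s (Finite.injective_iff_bijective.mp sinj)
  have e : (fun i => b (v i)) = (fun i => b (k.succAbove i)) ∘ σ := by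
    ext i; simp [σ, hs]
  rw [e, f.map_perm, g.map_perm, h k]

theorem core {V : Type*} [AddCommGroup V] [Module ℝ V]
    (hdim : Module.finrank ℝ V = 6)
    (J : V →ₗ[ℝ] V) (hJ : ∀ x, J (J x) = -x)
    (ψ : V [⋀^Fin 3]→ₗ[ℝ] ℝ)
    (hψtype : ∀ X Y Z : V, ψ ![J X, J Y, Z] = -ψ ![X, Y, Z])
    (e1 e2 e3 : V) (h1 : ψ ![e1, e2, e3] = 1) (h0 : ψ ![J e1, e2, e3] = 0) :
    (∀ β : V [⋀^Fin 2]→ₗ[ℝ] ℝ, (∀ X Y : V, β ![J X, J Y] = -β ![X, Y]) →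
      (∀ a0 a1 a2 a3 a4 : V,
        wedge23 (fun u v => β ![u, v]) ψ a0 a1 a2 a3 a4 = 0) → β = 0) ∧
    (∀ τ : V [⋀^Fin 5]→ₗ[ℝ] ℝ,
      ∃ β : V [⋀^Fin 2]→ₗ[ℝ] ℝ, (∀ X Y : V, β ![J X, J Y] = -β ![X, Y]) ∧
        ∀ a0 a1 a2 a3 a4 : V,
          τ ![a0, a1, a2, a3, a4] = wedge23 (fun u v => β ![u, v]) ψ a0 a1 a2 a3 a4) := by
  have padd : ∀ x y z w, ψ ![x + y, z, w] = ψ ![x, z, w] + ψ ![y, z, w] :=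
    fun x y z w => ψ.map_vecCons_add _ _ _
  have psmul : ∀ (c : ℝ) x z w, ψ ![c • x, z, w] = c * ψ ![x, z, w] :=
    fun c x z w => ψ.map_vecCons_smul _ _ _
  have pneg : ∀ x z w, ψ ![-x, z, w] = - ψ ![x, z, w] := fun x z w => by
    have := psmul (-1) x z w
    simpa using this
  have pzero : ∀ z w, ψ ![0, z, w] = 0 := fun z w => by
    have := psmul 0 0 z w
    simpa using this
  have m2 : ∀ x y z, ψ ![x, J y, z] = ψ ![J x, y, z] := fun x y z => by
    have := hψtype (J x) y z
    rw [hJ, pneg] at this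
    linarith
  have m3 : ∀ x y z, ψ ![x, y, J z] = ψ ![J x, y, z] := fun x y z => by
    rw [sw3' ψ x (J z) y, m2, sw3' ψ (J x) y z, neg_neg]
  have z1 : ∀ x z, ψ ![x, x, z] = 0 := fun x z => by have := sw3 ψ x x z; linarith
  have z2 : ∀ x z, ψ ![z, x, x] = 0 := fun x z => by have := sw3' ψ z x x; linarith
  have z3 : ∀ x z, ψ ![x, z, x] = 0 := fun x z => by rw [sw3', z1, neg_zero]
  have z4 : ∀ x z, ψ ![J x, x, z] = 0 := fun x z => by
    have := sw3 ψ x (J x) z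
    rw [m2] at this; linarith
  have z5 : ∀ x z, ψ ![J x, z, x] = 0 := fun x z => by rw [sw3', z4, neg_zero]
  have q1 : ψ ![e1, e3, e2] = -1 := by rw [sw3', h1]
  have q2 : ψ ![e2, e1, e3] = -1 := by rw [sw3, h1]
  have q3 : ψ ![e2, e3, e1] = 1 := by rw [sw3', q2, neg_neg]
  have q4 : ψ ![e3, e1, e2] = 1 := by rw [sw3, q1, neg_neg]
  have q5 : ψ ![e3, e2, e1] = -1 := by rw [sw3', q4]
  have r1 : ψ ![J e1, e3, e2] = 0 := by rw [sw3', h0, neg_zero]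
  have r2 : ψ ![J e2, e1, e3] = 0 := by rw [← m2, sw3, h0, neg_zero]
  have r3 : ψ ![J e2, e3, e1] = 0 := by rw [sw3', r2, neg_zero]
  have r4 : ψ ![J e3, e1, e2] = 0 := by rw [← m2, sw3, r1, neg_zero]
  have r5 : ψ ![J e3, e2, e1] = 0 := by rw [sw3', r4, neg_zero]
  have li : LinearIndependent ℝ ![e1, e2, e3, J e1, J e2, J e3] := by
    rw [Fintype.linearIndependent_iff]
    intro g hg
    simp only [Fin.sum_univ_six, Matrix.cons_val] at hg
    have ev : ∀ y z, ψ ![g 0 • e1 + g 1 • e2 + g 2 • e3 + g 3 • J e1 + g 4 • J e2 + g 5 • J e3,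
      y, z] = 0 := fun y z => by rw [hg, pzero]
    have t0 := ev e2 e3
    have t1 := ev e3 e1
    have t2 := ev e1 e2
    have t3 := ev (J e2) e3
    have t4 := ev (J e3) e1
    have t5 := ev (J e1) e2
    simp only [padd, psmul, m2, m3, hJ, map_neg, pneg, z1, z2, z3, z4, z5, h1, h0, q1, q2, q3, q4, q5,
      r1, r2, r3, r4, r5] at t0 t1 t2 t3 t4 t5
    intro i
    fin_cases i <;> simp <;> linarith
  let b := basisOfLinearIndependentOfCardEqFinrank li (by simp [hdim])
  have hb : ⇑b = ![e1, e2, e3, J e1, J e2, J e3] := coe_basisOfLinearIndependentOfCardEqFinrank li _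
  constructor
  · intro β hβ hw
    have bneg : ∀ x z, β ![-x, z] = - β ![x, z] := fun x z => by
      have : β ![(-1 : ℝ) • x, z] = (-1 : ℝ) * β ![x, z] := β.map_vecCons_smul _ _ _
      simpa using this
    have n2 : ∀ x y, β ![x, J y] = β ![J x, y] := fun x y => by
      have := hβ (J x) y
      rw [hJ, bneg] at this
      linarith
    have y1 : ∀ x, β ![x, x] = 0 := fun x => by have := sw2 β x x; linarith
    have y2 : ∀ x, β ![J x, x] = 0 := fun x => by
      have := sw2 β x (J x)
      rw [n2] at this; linarith
    have s1 := sw2 β e1 e2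
    have s2 := sw2 β e1 e3
    have s3 := sw2 β e2 e3
    have s4 : β ![J e2, e1] = - β ![J e1, e2] := by rw [← n2, sw2]
    have s5 : β ![J e3, e1] = - β ![J e1, e3] := by rw [← n2, sw2]
    have s6 : β ![J e3, e2] = - β ![J e2, e3] := by rw [← n2, sw2]
    have t0 := hw e2 e3 (J e1) (J e2) (J e3)
    have t1 := hw e1 e3 (J e1) (J e2) (J e3)
    have t2 := hw e1 e2 (J e1) (J e2) (J e3)
    have t3 := hw e1 e2 e3 (J e2) (J e3)
    have t4 := hw e1 e2 e3 (J e1) (J e3)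
    have t5 := hw e1 e2 e3 (J e1) (J e2)
    simp only [wedge23, m2, m3, hJ, map_neg, pneg, z1, z2, z3, z4, z5, h1, h0, q1, q2, q3, q4, q5,
      r1, r2, r3, r4, r5, n2, bneg, y1, y2, s1, s2, s3, s4, s5, s6] at t0 t1 t2 t3 t4 t5
    apply b.ext_alternating
    intro v hv
    have e : (fun i => b (v i)) = ![b (v 0), b (v 1)] := by
      ext i; fin_cases i <;> rfl
    rw [e, hb]
    generalize v 0 = i
    generalize v 1 = j
    fin_cases i <;> fin_cases j <;>
      simp [n2, hJ, map_neg, bneg, y1, y2, s1, s2, s3, s4, s5, s6] <;> linarith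
  · intro τ
    let T : Fin 6 → ℝ := fun k => τ (fun i => b (k.succAbove i))
    let v : V := (-T 3 / 2) • e1 + (T 4 / 2) • e2 + (-T 5 / 2) • e3 + (-T 0 / 2) • J e1 +
      (T 1 / 2) • J e2 + (-T 2 / 2) • J e3
    have hc : ∀ x y, ψ.curryLeft v ![x, y] = ψ ![v, x, y] := fun x y => rfl
    refine ⟨ψ.curryLeft v, ?_, ?_⟩
    · intro X Y
      rw [hc, hc, m3, hψtype]
    · have key : τ = wedge23A (ψ.curryLeft v) ψ := by
        apply ext5 b
        intro k
        change T k = wedge23 (fun u w => ψ.curryLeft v ![u, w]) ψ _ _ _ _ _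
        rw [hb]
        fin_cases k <;> simp [Fin.succAbove, wedge23, hc, -AlternatingMap.curryLeft_apply_apply]
        all_goals
          simp only [v, padd, psmul, m2, m3, hJ, map_neg, pneg, z1, z2, z3, z4, z5, h1, h0, q1, q2, q3, q4, q5, r1, r2, r3, r4, r5]
          ring
      intro a0 a1 a2 a3 a4
      exact congrArg (fun f => f ![a0, a1, a2, a3, a4]) key

/-- For a nonzero real 3-form `ψ` of type `(3,0)+(0,3)` on a Hermitian vector space of
real dimension 6, the map `η ↦ η ∧ ψ` from real `(2,0)+(0,2)`-forms (characterized by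
`β(J·,J·) = -β`) to 5-forms is bijective: it is injective and every 5-form is `β ∧ ψ`
for a unique such `β`. -/
theorem stmt16 (V : Type*) [NormedAddCommGroup V] [InnerProductSpace ℝ V]
    (hdim : Module.finrank ℝ V = 6)
    (J : V →ₗ[ℝ] V) (hJ2 : J ∘ₗ J = -LinearMap.id)
    (hJo : ∀ x y : V, ⟪J x, J y⟫ = ⟪x, y⟫)
    (ψ : V [⋀^Fin 3]→ₗ[ℝ] ℝ)
    (hψtype : ∀ X Y Z : V, ψ ![J X, J Y, Z] = -ψ ![X, Y, Z])
    (hψ0 : ψ ≠ 0) :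
    (∀ β : V [⋀^Fin 2]→ₗ[ℝ] ℝ, (∀ X Y : V, β ![J X, J Y] = -β ![X, Y]) →
      (∀ a0 a1 a2 a3 a4 : V,
        wedge23 (fun u v => β ![u, v]) ψ a0 a1 a2 a3 a4 = 0) → β = 0) ∧
    (∀ τ : V [⋀^Fin 5]→ₗ[ℝ] ℝ,
      ∃ β : V [⋀^Fin 2]→ₗ[ℝ] ℝ, (∀ X Y : V, β ![J X, J Y] = -β ![X, Y]) ∧
        ∀ a0 a1 a2 a3 a4 : V,
          τ ![a0, a1, a2, a3, a4] = wedge23 (fun u v => β ![u, v]) ψ a0 a1 a2 a3 a4) := by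
  have hJ : ∀ x, J (J x) = -x := fun x => by
    have := congrArg (fun f => f x) hJ2
    simpa using this
  obtain ⟨X, Y, Z, hp⟩ : ∃ X Y Z, ψ ![X, Y, Z] ≠ 0 := by
    by_contra hcon
    push Not at hcon
    apply hψ0
    ext v
    have e : v = ![v 0, v 1, v 2] := by
      ext i; fin_cases i <;> rfl
    rw [e, hcon]; rfl
  have padd : ∀ x y z w, ψ ![x + y, z, w] = ψ ![x, z, w] + ψ ![y, z, w] :=
    fun x y z w => ψ.map_vecCons_add _ _ _
  have psmul : ∀ (c : ℝ) x z w, ψ ![c • x, z, w] = c * ψ ![x, z, w] :=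
    fun c x z w => ψ.map_vecCons_smul _ _ _
  have pneg : ∀ x z w, ψ ![-x, z, w] = - ψ ![x, z, w] := fun x z w => by
    have := psmul (-1) x z w
    simpa using this
  have hn : ψ ![X, Y, Z] ^ 2 + ψ ![J X, Y, Z] ^ 2 ≠ 0 := by positivity
  refine core hdim J hJ ψ hψtype
    ((ψ ![X, Y, Z] / (ψ ![X, Y, Z] ^ 2 + ψ ![J X, Y, Z] ^ 2)) • X +
      (ψ ![J X, Y, Z] / (ψ ![X, Y, Z] ^ 2 + ψ ![J X, Y, Z] ^ 2)) • J X) Y Z ?_ ?_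
  · rw [padd, psmul, psmul]
    field_simp
  · rw [map_add, map_smul, map_smul, hJ, padd, psmul, psmul, pneg]
    ring
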